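/- arXiv:1604.00146 — 9 statements merged into one kernel-verified Lean document; each statement's English description precedes it below -/
import Mathlib

section
/- Let 𝔤 be a real Lie algebra, ω a skew-symmetric bilinear 2-cocycle on 𝔤 which is nondegenerate (ω(x,z) = 0 for all z implies x = 0), and let · : 𝔤 × 𝔤 → 𝔤 be a bilinear multiplication satisfying ω(x·y, z) = −ω(y, [x,z]) for all x,y,z ∈ 𝔤. Then (𝔤,·) is a left-symmetric algebra, and x·y − y·x = [x,y] for all x,y ∈ 𝔤; consequently ω is invariant and (𝔤, ·, ω) is a quadratic left-symmetric algebra. -/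
/-- Let 𝔤 be a real Lie algebra, ω a nondegenerate skew-symmetric
2-cocycle on 𝔤, and · a bilinear multiplication with ω(x·y, z) = −ω(y, [x,z]).
Then (𝔤,·) is a left-symmetric algebra, x·y − y·x = [x,y], and ω is invariant;
hence (𝔤, ·, ω) is a quadratic left-symmetric algebra. -/
theorem symplectic_lie_algebra_gives_quadratic_left_symmetric
    (V : Type*) [AddCommGroup V] [Module ℝ V]
    (bracket : V →ₗ[ℝ] V →ₗ[ℝ] V)
    (hbskew : ∀ x y : V, bracket x y = - bracket y x)
    (hjac : ∀ x y z : V,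
      bracket x (bracket y z) + bracket y (bracket z x) + bracket z (bracket x y) = 0)
    (ω : V →ₗ[ℝ] V →ₗ[ℝ] ℝ)
    (hωskew : ∀ x y : V, ω x y = - ω y x)
    (hcocycle : ∀ x y z : V, ω (bracket x y) z + ω (bracket y z) x + ω (bracket z x) y = 0)
    (hnd : ∀ x : V, (∀ z : V, ω x z = 0) → x = 0)
    (mul : V →ₗ[ℝ] V →ₗ[ℝ] V)
    (hmul : ∀ x y z : V, ω (mul x y) z = - ω y (bracket x z)) :
    (∀ x y z : V,
      mul x (mul y z) - mul (mul x y) z = mul y (mul x z) - mul (mul y x) z) ∧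
    (∀ x y : V, mul x y - mul y x = bracket x y) ∧
    (∀ x y z : V, ω (mul x y) z + ω y (mul x z - mul z x) = 0) := by
  have hcomm : ∀ x y : V, mul x y - mul y x = bracket x y := by
    intro x y
    refine sub_eq_zero.mp (hnd _ fun z => ?_)
    have hc := hcocycle x y z
    rw [hωskew (bracket y z) x, hωskew (bracket z x) y, hbskew z x, map_neg] at hc
    simp only [map_sub, LinearMap.sub_apply, hmul]
    linarith
  refine ⟨fun x y z => ?_, hcomm, fun x y z => ?_⟩
  · refine sub_eq_zero.mp (hnd _ fun w => ?_)
    have hbr : ω (mul (mul x y) z) w - ω (mul (mul y x) z) w = - ω z (bracket (bracket x y) w) := by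
      rw [← hmul, ← hcomm x y]
      simp only [map_sub, LinearMap.sub_apply]
    have hj := congrArg (ω z) (hjac x y w)
    rw [hbskew w x, hbskew w (bracket x y)] at hj
    simp only [map_add, map_neg, map_zero] at hj
    have hxy : ω (mul x (mul y z)) w = ω z (bracket y (bracket x w)) := by
      rw [hmul, hmul, neg_neg]
    have hyx : ω (mul y (mul x z)) w = ω z (bracket x (bracket y w)) := by
      rw [hmul, hmul, neg_neg]
    simp only [map_sub, LinearMap.sub_apply]
    linarith
  · rw [hcomm, hmul, neg_add_cancel]
end

section
/- Let (V,·) be a finite-dimensional real left-symmetric algebra with sub-adjacent bracket [x,y] = x·y − y·x, and define L*_x : V* → V* by ⟨L*_x ξ, y⟩ = −⟨ξ, x·y⟩. Define on V ⊕ V* the bracket [(x,ξ),(y,η)]_S := ([x,y], L*_x η − L*_y ξ) and the bilinear form ω((x,ξ),(y,η)) := ξ(y) − η(x). Then [·,·]_S is a Lie bracket on V ⊕ V*, ω is skew-symmetric and nondegenerate, and ω is a 2-cocycle for [·,·]_S; i.e. (V ⊕ V*, [·,·]_S, ω) is a symplectic (Frobenius) Lie algebra (the semidirect product V ⋉_{L*}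 V*). -/
open Module

/-- The dual representation operator: ⟨L*_x ξ, y⟩ = −⟨ξ, x·y⟩. -/
def Lstar {V : Type*} [AddCommGroup V] [Module ℝ V]
    (mul : V →ₗ[ℝ] V →ₗ[ℝ] V) (x : V) (ξ : Dual ℝ V) : Dual ℝ V :=
  -(ξ ∘ₗ mul x)

/-- The semidirect product bracket [(x,ξ),(y,η)]_S = ([x,y], L*_x η − L*_y ξ)
on V ⊕ V*. -/
def bracketS {V : Type*} [AddCommGroup V] [Module ℝ V]
    (mul : V →ₗ[ℝ] V →ₗ[ℝ] V) (p q : V × Dual ℝ V) : V × Dual ℝ V :=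
  (mul p.1 q.1 - mul q.1 p.1, Lstar mul p.1 q.2 - Lstar mul q.1 p.2)

/-- The canonical skew form ω((x,ξ),(y,η)) = ξ(y) − η(x) on V ⊕ V*. -/
def omegaS {V : Type*} [AddCommGroup V] [Module ℝ V]
    (p q : V × Dual ℝ V) : ℝ := p.2 q.1 - q.2 p.1

/-- For a finite-dimensional real left-symmetric algebra (V,·), the
semidirect product V ⋉_{L*} V* with the canonical skew form ω is a symplectic
(Frobenius) Lie algebra: [·,·]_S is a Lie bracket, ω is skew-symmetric,
nondegenerate, and a 2-cocycle for [·,·]_S. -/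
theorem semidirect_product_symplectic_lie_algebra
    (V : Type*) [AddCommGroup V] [Module ℝ V] [FiniteDimensional ℝ V]
    (mul : V →ₗ[ℝ] V →ₗ[ℝ] V)
    (hls : ∀ x y z : V,
      mul x (mul y z) - mul (mul x y) z = mul y (mul x z) - mul (mul y x) z) :
    (∀ p q : V × Dual ℝ V, bracketS mul p q = - bracketS mul q p) ∧
    (∀ p q r : V × Dual ℝ V,
      bracketS mul p (bracketS mul q r) + bracketS mul q (bracketS mul r p)
        + bracketS mul r (bracketS mul p q) = 0) ∧
    (∀ p q : V × Dual ℝ V, omegaS p q = - omegaS q p) ∧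
    (∀ p : V × Dual ℝ V, (∀ q : V × Dual ℝ V, omegaS p q = 0) → p = 0) ∧
    (∀ p q r : V × Dual ℝ V,
      omegaS (bracketS mul p q) r + omegaS (bracketS mul q r) p
        + omegaS (bracketS mul r p) q = 0) := by
  refine ⟨?_, ?_, ?_, ?_, ?_⟩
  · rintro ⟨x, ξ⟩ ⟨y, η⟩
    simp [bracketS]
  · rintro ⟨x, ξ⟩ ⟨y, η⟩ ⟨z, ζ⟩
    refine Prod.ext ?_ (LinearMap.ext fun w => ?_)
    · simp only [bracketS, Prod.fst_add, Prod.fst_zero, map_sub, LinearMap.sub_apply]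
      linear_combination (norm := module) hls x y z + hls y z x + hls z x y
    · have hξ := congrArg ξ (hls y z w)
      have hη := congrArg η (hls z x w)
      have hζ := congrArg ζ (hls x y w)
      simp only [map_sub] at hξ hη hζ
      simp only [bracketS, Lstar, Prod.snd_add, Prod.snd_zero, map_sub, LinearMap.sub_apply,
        LinearMap.add_apply, LinearMap.neg_apply, LinearMap.comp_apply, LinearMap.zero_apply]
      linarith
  · intro p q
    simp [omegaS]
  · rintro ⟨x, ξ⟩ h
    refine Prod.ext ?_ (LinearMap.ext fun y => ?_)
    · exact (forall_dual_apply_eq_zero_iff ℝ x).mp fun η => by simpa [omegaS] using h (0, η)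
    · simpa [omegaS] using h (y, 0)
  · rintro ⟨x, ξ⟩ ⟨y, η⟩ ⟨z, ζ⟩
    simp only [bracketS, omegaS, Lstar, map_sub, LinearMap.sub_apply, LinearMap.neg_apply,
      LinearMap.comp_apply]
    ring
end

section
/- Let (E, ⋆, ρ, (·,·)₋, D) be a pre-symplectic algebroid datum over a commutative ℝ-algebra R. Then for all e₁, e₂ ∈ E and f ∈ R: (1) e₁ ⋆ (f·e₂) = f·(e₁⋆e₂) + ρ(e₁)(f)·e₂ + (1/2)·(e₁,e₂)₋·Df; (2) [e₁, f·e₂] = f·[e₁,e₂] + ρ(e₁)(f)·e₂; (3) (f·e₁) ⋆ e₂ = f·(e₁⋆e₂) − (1/2)·(e₁,e₂)₋·Df. -/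
/-- A pre-symplectic algebroid datum over a commutative ℝ-algebra `R`
(modeling smooth functions on a manifold): an `R`-module `E` with an
ℝ-bilinear multiplication `⋆`, an anchor `ρ : E → Der_ℝ(R)`, a nondegenerate
R-bilinear skew-symmetric form `(·,·)₋`, and an ℝ-linear map `D : R → E` with
`(Df, e)₋ = ρ(e)(f)`, satisfying axioms (i) and (ii). -/
structure PreSympAlgebroid (R E : Type*) [CommRing R] [Algebra ℝ R]
    [AddCommGroup E] [Module R E] [Module ℝ E] [IsScalarTower ℝ R E] where
  star : E →ₗ[ℝ] E →ₗ[ℝ] E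
  rho : E →ₗ[R] Derivation ℝ R R
  form : E →ₗ[R] E →ₗ[R] R
  form_skew : ∀ e₁ e₂ : E, form e₁ e₂ = - form e₂ e₁
  form_nondeg : ∀ x : E, (∀ e : E, form x e = 0) → x = 0
  D : R →ₗ[ℝ] E
  form_D : ∀ (f : R) (e : E), form (D f) e = rho e f
  /-- Axiom (i): the symmetrized associator is (1/6)·D(T(e₁,e₂,e₃)). -/
  axiom_i : ∀ e₁ e₂ e₃ : E,
    star e₁ (star e₂ e₃) - star (star e₁ e₂) e₃
      - star e₂ (star e₁ e₃) + star (star e₂ e₁) e₃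
    = (6 : ℝ)⁻¹ • D (form (star e₁ e₂) e₃ + form e₁ (star e₂ e₃)
        - form (star e₂ e₁) e₃ - form e₂ (star e₁ e₃))
  /-- Axiom (ii). -/
  axiom_ii : ∀ e₁ e₂ e₃ : E,
    rho e₁ (form e₂ e₃)
      = form (star e₁ e₂ - (2 : ℝ)⁻¹ • D (form e₁ e₂)) e₃
        + form e₂ (star e₁ e₃ - star e₃ e₁)

namespace PreSympAlgebroid

variable {R E : Type*} [CommRing R] [Algebra ℝ R]
  [AddCommGroup E] [Module R E] [Module ℝ E] [IsScalarTower ℝ R E]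
  (P : PreSympAlgebroid R E)

theorem form_real_smul_left (c : ℝ) (x y : E) :
    P.form (c • x) y = algebraMap ℝ R c * P.form x y := by
  rw [← algebraMap_smul R c x, map_smul, LinearMap.smul_apply, smul_eq_mul]

theorem ext_form_left {x y : E} (h : ∀ e, P.form x e = P.form y e) : x = y :=
  sub_eq_zero.mp <| P.form_nondeg _ fun e => by
    rw [map_sub, LinearMap.sub_apply, h, sub_self]

theorem ext_form_right {x y : E} (h : ∀ e, P.form e x = P.form e y) : x = y :=
  P.ext_form_left fun e => by rw [P.form_skew, h, ← P.form_skew]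

theorem star_smul (e₁ e₂ : E) (f : R) :
    P.star e₁ (f • e₂)
      = f • P.star e₁ e₂ + P.rho e₁ f • e₂ + (2 : ℝ)⁻¹ • (P.form e₁ e₂ • P.D f) := by
  refine P.ext_form_left fun e => ?_
  have h := P.axiom_ii e₁ e₂ e
  have hf := P.axiom_ii e₁ (f • e₂) e
  simp only [map_smul, map_sub, map_add, LinearMap.smul_apply, LinearMap.sub_apply,
    LinearMap.add_apply, smul_eq_mul, form_real_smul_left, form_D, Derivation.leibniz]
    at h hf ⊢
  linear_combination f * h - hf

theorem bracket_smul (e₁ e₂ : E) (f : R) :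
    P.star e₁ (f • e₂) - P.star (f • e₂) e₁
      = f • (P.star e₁ e₂ - P.star e₂ e₁) + P.rho e₁ f • e₂ := by
  refine P.ext_form_right fun e => ?_
  have h := P.axiom_ii e₁ e e₂
  have hf := P.axiom_ii e₁ e (f • e₂)
  simp only [map_smul, map_add, smul_eq_mul, Derivation.leibniz] at h hf ⊢
  linear_combination f * h - hf

theorem smul_star (e₁ e₂ : E) (f : R) :
    P.star (f • e₁) e₂
      = f • P.star e₁ e₂ - (2 : ℝ)⁻¹ • (P.form e₁ e₂ • P.D f) := by
  have h := P.bracket_smul e₂ e₁ f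
  rw [P.star_smul, P.form_skew e₂ e₁, neg_smul, smul_neg, smul_sub] at h
  rw [← sub_eq_zero] at h ⊢
  rw [← neg_eq_zero, ← h]
  abel

end PreSympAlgebroid

/-- In a pre-symplectic algebroid datum, for all e₁, e₂ ∈ E and f ∈ R:
(1) e₁ ⋆ (f·e₂) = f·(e₁⋆e₂) + ρ(e₁)(f)·e₂ + (1/2)·(e₁,e₂)₋·Df;
(2) [e₁, f·e₂] = f·[e₁,e₂] + ρ(e₁)(f)·e₂;
(3) (f·e₁) ⋆ e₂ = f·(e₁⋆e₂) − (1/2)·(e₁,e₂)₋·Df. -/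
theorem presymp_anchor_properties
    (R E : Type*) [CommRing R] [Algebra ℝ R]
    [AddCommGroup E] [Module R E] [Module ℝ E] [IsScalarTower ℝ R E]
    (P : PreSympAlgebroid R E) :
    (∀ (e₁ e₂ : E) (f : R),
      P.star e₁ (f • e₂)
        = f • P.star e₁ e₂ + P.rho e₁ f • e₂ + (2 : ℝ)⁻¹ • (P.form e₁ e₂ • P.D f)) ∧
    (∀ (e₁ e₂ : E) (f : R),
      P.star e₁ (f • e₂) - P.star (f • e₂) e₁
        = f • (P.star e₁ e₂ - P.star e₂ e₁) + P.rho e₁ f • e₂) ∧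
    (∀ (e₁ e₂ : E) (f : R),
      P.star (f • e₁) e₂
        = f • P.star e₁ e₂ - (2 : ℝ)⁻¹ • (P.form e₁ e₂ • P.D f)) :=
  ⟨P.star_smul, P.bracket_smul, P.smul_star⟩
end

section
/- Let (E, [·,·], ρ, ω) be a symplectic Lie algebroid datum over a commutative ℝ-algebra R, let D : R → E be an ℝ-linear map satisfying ω(Df, e) = ρ(e)(f) for all f ∈ R, e ∈ E, and let ⋆ : E × E → E be an ℝ-bilinear multiplication satisfying ω(e₁⋆e₂, e₃) = ρ(e₁)(ω(e₂,e₃)) + (1/2)·ρ(e₃)(ω(e₁,e₂)) − ω(e₂, [e₁,e₃]) for all e₁,e₂,e₃ ∈ E. Then e₁⋆e₂ − e₂⋆e₁ = [e₁,e₂] for all e₁,e₂ ∈ E, and (E, ⋆, ρ, ω, D) is a pre-symplectic algebroid datum, i.e. with T(e₁,e₂,e₃) := ω(e₁⋆e₂, e₃) + ω(e₁, e₂⋆e₃) − ω(e₂⋆e₁, e₃) − ω(e₂, e₁⋆e₃) one has (i) e₁⋆(e₂⋆e₃) − (e₁⋆e₂)⋆e₃ − e₂⋆(e₁⋆e₃)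 + (e₂⋆e₁)⋆e₃ = (1/6)·D(T(e₁,e₂,e₃)) and (ii) ρ(e₁)(ω(e₂,e₃)) = ω(e₁⋆e₂ − (1/2)·D(ω(e₁,e₂)), e₃) + ω(e₂, [e₁,e₃]) for all e₁,e₂,e₃ ∈ E. -/
/-- Let (E, [·,·], ρ, ω) be a symplectic Lie algebroid datum over a
commutative ℝ-algebra R, D : R → E with ω(Df, e) = ρ(e)(f), and ⋆ the
multiplication defined by ω(e₁⋆e₂, e₃) = ρ(e₁)(ω(e₂,e₃)) + (1/2)·ρ(e₃)(ω(e₁,e₂))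
− ω(e₂, [e₁,e₃]). Then e₁⋆e₂ − e₂⋆e₁ = [e₁,e₂], and (E, ⋆, ρ, ω, D) is a
pre-symplectic algebroid datum (axioms (i) and (ii) hold). -/
theorem symplectic_lie_algebroid_gives_presymp
    (R E : Type*) [CommRing R] [Algebra ℝ R]
    [AddCommGroup E] [Module R E] [Module ℝ E] [IsScalarTower ℝ R E]
    (bracket : E →ₗ[ℝ] E →ₗ[ℝ] E)
    (hskew : ∀ e₁ e₂ : E, bracket e₁ e₂ = - bracket e₂ e₁)
    (hjac : ∀ e₁ e₂ e₃ : E,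
      bracket e₁ (bracket e₂ e₃) + bracket e₂ (bracket e₃ e₁)
        + bracket e₃ (bracket e₁ e₂) = 0)
    (rho : E →ₗ[R] Derivation ℝ R R)
    (hanchor : ∀ (e₁ e₂ : E) (f : R),
      rho (bracket e₁ e₂) f = rho e₁ (rho e₂ f) - rho e₂ (rho e₁ f))
    (hleib : ∀ (e₁ e₂ : E) (f : R),
      bracket e₁ (f • e₂) = f • bracket e₁ e₂ + rho e₁ f • e₂)
    (ω : E →ₗ[R] E →ₗ[R] R)
    (hωskew : ∀ e₁ e₂ : E, ω e₁ e₂ = - ω e₂ e₁)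
    (hωnondeg : ∀ x : E, (∀ e : E, ω x e = 0) → x = 0)
    (hωclosed : ∀ e₁ e₂ e₃ : E,
      rho e₁ (ω e₂ e₃) - rho e₂ (ω e₁ e₃) + rho e₃ (ω e₁ e₂)
        - ω (bracket e₁ e₂) e₃ + ω (bracket e₁ e₃) e₂ - ω (bracket e₂ e₃) e₁ = 0)
    (D : R →ₗ[ℝ] E)
    (hD : ∀ (f : R) (e : E), ω (D f) e = rho e f)
    (star : E →ₗ[ℝ] E →ₗ[ℝ] E)
    (hstar : ∀ e₁ e₂ e₃ : E,
      ω (star e₁ e₂) e₃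
        = rho e₁ (ω e₂ e₃) + (2 : ℝ)⁻¹ • rho e₃ (ω e₁ e₂) - ω e₂ (bracket e₁ e₃)) :
    (∀ e₁ e₂ : E, star e₁ e₂ - star e₂ e₁ = bracket e₁ e₂) ∧
    (∀ e₁ e₂ e₃ : E,
      star e₁ (star e₂ e₃) - star (star e₁ e₂) e₃
        - star e₂ (star e₁ e₃) + star (star e₂ e₁) e₃
      = (6 : ℝ)⁻¹ • D (ω (star e₁ e₂) e₃ + ω e₁ (star e₂ e₃)
          - ω (star e₂ e₁) e₃ - ω e₂ (star e₁ e₃))) ∧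
    (∀ e₁ e₂ e₃ : E,
      rho e₁ (ω e₂ e₃)
        = ω (star e₁ e₂ - (2 : ℝ)⁻¹ • D (ω e₁ e₂)) e₃
          + ω e₂ (star e₁ e₃ - star e₃ e₁)) := by
  have ω_ext : ∀ x y : E, (∀ e, ω x e = ω y e) → x = y := fun x y h =>
    sub_eq_zero.mp (hωnondeg _ fun e => by simp [h e])
  have commutator : ∀ a b : E, star a b - star b a = bracket a b := by
    refine fun a b => ω_ext _ _ fun c => ?_
    have hclosed := hωclosed a b c
    rw [hωskew (bracket a c) b, hωskew (bracket b c) a] at hclosed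
    rw [map_sub, LinearMap.sub_apply, hstar, hstar, hωskew b a, map_neg]
    linear_combination (norm := module) hclosed
  have ω_star_right : ∀ a b c : E, ω a (star b c)
      = rho b (ω a c) - (2 : ℝ)⁻¹ • rho a (ω b c) + ω (bracket a b) c := by
    intro a b c
    rw [hωskew a (star b c), hstar, hskew b a, map_neg, hωskew c a, map_neg,
      hωskew c (bracket a b)]
    module
  refine ⟨commutator, fun a b c => ?_, fun a b c => ?_⟩
  · have lhs_eq : star a (star b c) - star (star a b) c - star b (star a c) + star (star b a) c
        = star a (star b c) - star b (star a c) - star (bracket a b) c := by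
      rw [← commutator a b, map_sub, LinearMap.sub_apply]
      abel
    have torsion_eq : ω (star a b) c + ω a (star b c) - ω (star b a) c - ω b (star a c)
        = (3 : ℝ) • ω (bracket a b) c
          - (3 / 2 : ℝ) • (rho a (ω b c) - rho b (ω a c)) := by
      have h : ω (bracket a b) c = ω (star a b) c - ω (star b a) c := by
        rw [← commutator a b, map_sub, LinearMap.sub_apply]
      have h' : ω (bracket b a) c = - ω (bracket a b) c := by
        rw [hskew b a, map_neg, LinearMap.neg_apply]
      rw [ω_star_right, ω_star_right, h']
      linear_combination (norm := module) -h
    rw [lhs_eq, torsion_eq, ← map_smul]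
    refine ω_ext _ _ fun d => ?_
    have jacobi : bracket (bracket a b) d
        = bracket a (bracket b d) - bracket b (bracket a d) := by
      have h := hjac a b d
      rw [hskew d a, map_neg, hskew d (bracket a b)] at h
      rw [← sub_eq_zero, ← neg_eq_zero, ← h]
      abel
    have h' : ω (bracket b a) c = - ω (bracket a b) c := by
      rw [hskew b a, map_neg, LinearMap.neg_apply]
    simp only [map_sub, map_add, LinearMap.sub_apply, hstar, ω_star_right, hD, jacobi,
      hanchor, h', map_neg, Derivation.map_smul]
    module
  · rw [commutator, ← map_smul, map_sub, LinearMap.sub_apply, hD, hstar, Derivation.map_smul]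
    abel
end

section
/- Let (E, ⋆, ρ, (·,·)₋, D) be a pre-symplectic algebroid datum over a commutative ℝ-algebra R, and let F ⊆ E be an R-submodule which equals its own orthogonal complement: F = {e ∈ E : (e,f)₋ = 0 for all f ∈ F}. Then F is closed under ⋆ (f₁⋆f₂ ∈ F for all f₁,f₂ ∈ F) if and only if F is closed under the commutator bracket ([f₁,f₂] = f₁⋆f₂ − f₂⋆f₁ ∈ F for all f₁,f₂ ∈ F). In other words, Dirac structures correspond exactly to Lagrangian subalgebroids of the associated symplectic Lie algebroid datum. -/
/-- Let F be an R-submodule of a pre-symplectic algebroid datum which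
equals its own orthogonal complement. Then F is closed under ⋆ iff F is closed under
the commutator bracket: Dirac structures correspond exactly to Lagrangian
subalgebroids of the associated symplectic Lie algebroid datum. -/
theorem dirac_iff_lagrangian
    (R E : Type*) [CommRing R] [Algebra ℝ R]
    [AddCommGroup E] [Module R E] [Module ℝ E] [IsScalarTower ℝ R E]
    (P : PreSympAlgebroid R E) (F : Submodule R E)
    (hlag : ∀ e : E, e ∈ F ↔ ∀ f ∈ F, P.form e f = 0) :
    (∀ f₁ ∈ F, ∀ f₂ ∈ F, P.star f₁ f₂ ∈ F) ↔
    (∀ f₁ ∈ F, ∀ f₂ ∈ F, P.star f₁ f₂ - P.star f₂ f₁ ∈ F) := by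
  refine ⟨fun h f₁ h₁ f₂ h₂ => F.sub_mem (h f₁ h₁ f₂ h₂) (h f₂ h₂ f₁ h₁),
    fun h f₁ h₁ f₂ h₂ => (hlag _).2 fun f₃ h₃ => ?_⟩
  have hax := P.axiom_ii f₁ f₂ f₃
  rw [(hlag f₂).1 h₂ f₃ h₃, (hlag f₁).1 h₁ f₂ h₂,
    (hlag f₂).1 h₂ _ (h f₁ h₁ f₃ h₃)] at hax
  simpa using hax.symm
end

section
/- Let (V, ·, ω) be a quadratic left-symmetric algebra over ℝ and P : V → V a para-complex structure on it. Then (V, [·,·], ω, P) is a para-Kähler Lie algebra, where [x,y] := x·y − y·x; that is: [·,·] is a Lie bracket, ω is a nondegenerate skew-symmetric 2-cocycle for [·,·], P satisfies P[x,y] = [Px,y] + [x,Py] − P[Px,Py] for all x,y ∈ V, and ω(Px,y) + ω(x,Py) = 0 for all x,y ∈ V. -/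
/-- Let (V, ·, ω) be a quadratic left-symmetric algebra over ℝ and
P a para-complex structure on it. Then (V, [·,·], ω, P) is a para-Kähler Lie
algebra, where [x,y] := x·y − y·x: the bracket is a Lie bracket, ω is a
nondegenerate skew-symmetric 2-cocycle for it, P satisfies the Lie
integrability condition, and ω(Px,y) + ω(x,Py) = 0. -/
theorem paracomplex_quadratic_lsa_gives_parakahler
    (V : Type*) [AddCommGroup V] [Module ℝ V]
    (mul : V →ₗ[ℝ] V →ₗ[ℝ] V)
    (hls : ∀ x y z : V,
      mul x (mul y z) - mul (mul x y) z = mul y (mul x z) - mul (mul y x) z)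
    (ω : V →ₗ[ℝ] V →ₗ[ℝ] ℝ)
    (hωskew : ∀ x y : V, ω x y = - ω y x)
    (hnd : ∀ x : V, (∀ z : V, ω x z = 0) → x = 0)
    (hinv : ∀ x y z : V, ω (mul x y) z + ω y (mul x z - mul z x) = 0)
    (P : V →ₗ[ℝ] V)
    (hP2 : ∀ x : V, P (P x) = x)
    (hPω : ∀ x y : V, ω (P x) (P y) = - ω x y)
    (hPint : ∀ x y : V,
      P (mul x y) = mul (P x) y + mul x (P y) - P (mul (P x) (P y))) :
    (∀ x y : V, mul x y - mul y x = -(mul y x - mul x y)) ∧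
    (∀ x y z : V,
      ((mul x (mul y z - mul z y) - mul (mul y z - mul z y) x)
        + (mul y (mul z x - mul x z) - mul (mul z x - mul x z) y))
        + (mul z (mul x y - mul y x) - mul (mul x y - mul y x) z) = 0) ∧
    (∀ x y : V, ω x y = - ω y x) ∧
    (∀ x : V, (∀ z : V, ω x z = 0) → x = 0) ∧
    (∀ x y z : V,
      ω (mul x y - mul y x) z + ω (mul y z - mul z y) x + ω (mul z x - mul x z) y = 0) ∧
    (∀ x y : V,
      P (mul x y - mul y x)
        = (mul (P x) y - mul y (P x)) + (mul x (P y) - mul (P y) x)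
          - P (mul (P x) (P y) - mul (P y) (P x))) ∧
    (∀ x y : V, ω (P x) y + ω x (P y) = 0) := by
  refine ⟨fun x y => (neg_sub _ _).symm, fun x y z => ?_, hωskew, hnd, fun x y z => ?_,
    fun x y => ?_, fun x y => ?_⟩
  · have hxy := hls x y z
    have hyz := hls y z x
    have hzx := hls z x y
    simp only [map_sub, LinearMap.sub_apply]
    linear_combination (norm := module) hxy + hyz + hzx
  · have hxy := hinv x y z
    have hyx := hinv y x z
    rw [hωskew y] at hxy
    rw [hωskew x] at hyx
    simp only [map_sub, LinearMap.sub_apply] at hxy hyx ⊢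
    linear_combination hxy - hyx
  · rw [map_sub, map_sub, hPint x y, hPint y x]
    abel
  · have h := hPω x (P y)
    rw [hP2] at h
    linear_combination h
end

section
/- Let (V, ·, ω) be a quadratic left-symmetric algebra over ℝ and P : V → V a para-complex structure on it. Then the eigenspaces V⁺ = ker(P − id) and V⁻ = ker(P + id) are isotropic with respect to ω (ω(u,v) = 0 for u,v in the same eigenspace), each is closed under the multiplication · (u·v ∈ V⁺ for u,v ∈ V⁺, and u·v ∈ V⁻ for u,v ∈ V⁻), and V = V⁺ ⊕ V⁻; i.e. V⁺ and V⁻ are transversal Dirac structures. -/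
/-- For a quadratic left-symmetric algebra (V, ·, ω) over ℝ with a
para-complex structure P, the eigenspaces V⁺ = ker(P − id) and V⁻ = ker(P + id)
are isotropic w.r.t. ω, closed under the multiplication, and V = V⁺ ⊕ V⁻;
i.e. V⁺ and V⁻ are transversal Dirac structures. -/
theorem paracomplex_eigenspaces_transversal_dirac
    (V : Type*) [AddCommGroup V] [Module ℝ V]
    (mul : V →ₗ[ℝ] V →ₗ[ℝ] V)
    (hls : ∀ x y z : V,
      mul x (mul y z) - mul (mul x y) z = mul y (mul x z) - mul (mul y x) z)
    (ω : V →ₗ[ℝ] V →ₗ[ℝ] ℝ)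
    (hωskew : ∀ x y : V, ω x y = - ω y x)
    (hnd : ∀ x : V, (∀ z : V, ω x z = 0) → x = 0)
    (hinv : ∀ x y z : V, ω (mul x y) z + ω y (mul x z - mul z x) = 0)
    (P : V →ₗ[ℝ] V)
    (hP2 : ∀ x : V, P (P x) = x)
    (hPω : ∀ x y : V, ω (P x) (P y) = - ω x y)
    (hPint : ∀ x y : V,
      P (mul x y) = mul (P x) y + mul x (P y) - P (mul (P x) (P y))) :
    (∀ u v : V, P u = u → P v = v → ω u v = 0) ∧
    (∀ u v : V, P u = -u → P v = -v → ω u v = 0) ∧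
    (∀ u v : V, P u = u → P v = v → P (mul u v) = mul u v) ∧
    (∀ u v : V, P u = -u → P v = -v → P (mul u v) = -(mul u v)) ∧
    IsCompl (LinearMap.ker (P - (LinearMap.id : V →ₗ[ℝ] V)))
      (LinearMap.ker (P + (LinearMap.id : V →ₗ[ℝ] V))) := by
  have eq_of_add_self {a b : V} (h : a + a = b + b) : a = b := by
    rw [← two_smul ℝ a, ← two_smul ℝ b] at h
    exact smul_right_injective V (two_ne_zero' ℝ) h
  refine ⟨fun u v hu hv => ?_, fun u v hu hv => ?_, fun u v hu hv => ?_,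
    fun u v hu hv => ?_, ?_⟩
  · have h := hPω u v
    rw [hu, hv] at h
    linarith
  · have h := hPω u v
    rw [hu, hv] at h
    simp only [map_neg, LinearMap.neg_apply] at h
    linarith
  · have h := hPint u v
    rw [hu, hv] at h
    exact eq_of_add_self (eq_sub_iff_add_eq.mp h)
  · have h := hPint u v
    rw [hu, hv] at h
    simp only [map_neg, LinearMap.neg_apply, neg_neg] at h
    exact eq_of_add_self (eq_sub_iff_add_eq.mp h)
  · constructor
    · rw [Submodule.disjoint_def]
      intro x hx hx'
      simp only [LinearMap.mem_ker, LinearMap.sub_apply, LinearMap.add_apply,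
        LinearMap.id_apply, sub_eq_zero] at hx hx'
      rw [hx] at hx'
      exact eq_of_add_self (by simpa using hx')
    · rw [codisjoint_iff, Submodule.eq_top_iff']
      intro x
      refine Submodule.mem_sup.mpr
        ⟨(2⁻¹ : ℝ) • (x + P x), ?_, (2⁻¹ : ℝ) • (x - P x), ?_, by module⟩
      · simp only [LinearMap.mem_ker, LinearMap.sub_apply, LinearMap.id_apply,
          map_smul, map_add, hP2]
        module
      · simp only [LinearMap.mem_ker, LinearMap.add_apply, LinearMap.id_apply,
          map_smul, map_sub, hP2]
        module
end

section
/- Let 𝔤 be a real Lie algebra with a symmetric nondegenerate bilinear form g, let P : 𝔤 → 𝔤 be a linear map with P² = id and g(Px, Py) = −g(x,y) for all x,y, and let ∇ : 𝔤 × 𝔤 → 𝔤 be a bilinear Levi-Civita connection for g (2·g(∇_x y, z) = g([z,x],y) + g([z,y],x) + g([x,y],z)) satisfying ∇_x (Py) = P(∇_x y) for all x,y. Then ω(x,y) := g(x, Py) is a skew-symmetric nondegenerate 2-cocycle on 𝔤, ω(Px,y) + ω(x,Py) = 0 for all x,y, and P satisfies the integrability condition P[x,y] = [Px,y] + [x,Py]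 − P[Px,Py]; i.e. (𝔤, ω, P) is a para-Kähler Lie algebra. -/
/-- Let 𝔤 be a real Lie algebra with a symmetric nondegenerate
bilinear form g, P linear with P² = id and g(Px,Py) = −g(x,y), and ∇ a bilinear
Levi-Civita connection for g satisfying ∇_x(Py) = P(∇_x y). Then
ω(x,y) := g(x, Py) is a skew-symmetric nondegenerate 2-cocycle on 𝔤,
ω(Px,y) + ω(x,Py) = 0, and P satisfies the integrability condition;
i.e. (𝔤, ω, P) is a para-Kähler Lie algebra. -/
theorem pseudo_riemannian_gives_parakahler
    (L : Type*) [LieRing L] [LieAlgebra ℝ L]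
    (g : L →ₗ[ℝ] L →ₗ[ℝ] ℝ)
    (hgsymm : ∀ x y : L, g x y = g y x)
    (hgnd : ∀ x : L, (∀ y : L, g x y = 0) → x = 0)
    (P : L →ₗ[ℝ] L)
    (hP2 : ∀ x : L, P (P x) = x)
    (hPg : ∀ x y : L, g (P x) (P y) = - g x y)
    (nabla : L →ₗ[ℝ] L →ₗ[ℝ] L)
    (hK : ∀ x y z : L,
      2 * g (nabla x y) z = g ⁅z, x⁆ y + g ⁅z, y⁆ x + g ⁅x, y⁆ z)
    (hcomm : ∀ x y : L, nabla x (P y) = P (nabla x y)) :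
    (∀ x y : L, g x (P y) = - g y (P x)) ∧
    (∀ x : L, (∀ y : L, g x (P y) = 0) → x = 0) ∧
    (∀ x y z : L, g ⁅x, y⁆ (P z) + g ⁅y, z⁆ (P x) + g ⁅z, x⁆ (P y) = 0) ∧
    (∀ x y : L, g (P x) (P y) + g x (P (P y)) = 0) ∧
    (∀ x y : L, P ⁅x, y⁆ = ⁅P x, y⁆ + ⁅x, P y⁆ - P ⁅P x, P y⁆) := by
  have hskew : ∀ x y : L, g x (P y) = - g y (P x) := fun x y => by
    have h := hPg x (P y)
    rw [hP2, hgsymm] at h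
    linarith
  have hanti : ∀ x y z : L, g ⁅x, y⁆ z = - g ⁅y, x⁆ z := fun x y z => by
    rw [← lie_skew x y, map_neg, LinearMap.neg_apply]
  have htorsion : ∀ x y : L, ⁅x, y⁆ = nabla x y - nabla y x := fun x y => by
    refine sub_eq_zero.mp (hgnd _ fun z => ?_)
    simp only [map_sub, LinearMap.sub_apply]
    linarith [hK x y z, hK y x z, hanti x y z]
  have hmetric : ∀ x y z : L, g (nabla x y) z = - g (nabla x z) y := fun x y z => by
    linarith [hK x y z, hK x z y, hanti x y z, hanti x z y, hanti y z x]
  have hparallel : ∀ x y z : L, g (nabla x y) (P z) = g (nabla x z) (P y) := fun x y z => by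
    rw [hmetric, hcomm, hgsymm, hskew, neg_neg]
  refine ⟨hskew, fun x hx => hgnd x fun y => ?_, fun x y z => ?_, fun x y => ?_, fun x y => ?_⟩
  · simpa only [hP2] using hx (P y)
  · simp only [htorsion, map_sub, LinearMap.sub_apply]
    linarith [hparallel x y z, hparallel y z x, hparallel z x y]
  · rw [hPg, hP2, neg_add_cancel]
  · simp only [htorsion, hcomm, map_sub, hP2]
    abel
end

section
/- Let (V, ·, ω) be a quadratic left-symmetric algebra over ℝ with a para-complex structure P, let [x,y] := x·y − y·x, define g(x,y) := ω(x, Py), and let ∇ : V × V → V be a bilinear Levi-Civita connection for g, i.e. 2·g(∇_x y, z) = g([z,x],y) + g([z,y],x) + g([x,y],z) for all x,y,z ∈ V. Then the multiplication restricted to the eigenspaces of P agrees with ∇: for all x,y ∈ V⁺ = ker(P − id) one has ∇_x y = x·y, and for all ξ,η ∈ V⁻ = ker(P + id) one has ∇_ξ η = ξ·η. -/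
/-- Let (V, ·, ω) be a quadratic left-symmetric algebra over ℝ with a
para-complex structure P, let [x,y] := x·y − y·x, g(x,y) := ω(x, Py), and let ∇ be
a bilinear Levi-Civita connection for g. Then the multiplication restricted to the
eigenspaces of P agrees with ∇: ∇_x y = x·y on V⁺ = ker(P − id) and ∇_ξ η = ξ·η on
V⁻ = ker(P + id). -/
theorem multiplication_is_levi_civita_on_eigenspaces
    (V : Type*) [AddCommGroup V] [Module ℝ V]
    (mul : V →ₗ[ℝ] V →ₗ[ℝ] V)
    (hls : ∀ x y z : V,
      mul x (mul y z) - mul (mul x y) z = mul y (mul x z) - mul (mul y x) z)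
    (ω : V →ₗ[ℝ] V →ₗ[ℝ] ℝ)
    (hωskew : ∀ x y : V, ω x y = - ω y x)
    (hnd : ∀ x : V, (∀ z : V, ω x z = 0) → x = 0)
    (hinv : ∀ x y z : V, ω (mul x y) z + ω y (mul x z - mul z x) = 0)
    (P : V →ₗ[ℝ] V)
    (hP2 : ∀ x : V, P (P x) = x)
    (hPω : ∀ x y : V, ω (P x) (P y) = - ω x y)
    (hPint : ∀ x y : V,
      P (mul x y) = mul (P x) y + mul x (P y) - P (mul (P x) (P y)))
    (g : V → V → ℝ)
    (hg : ∀ x y : V, g x y = ω x (P y))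
    (nabla : V →ₗ[ℝ] V →ₗ[ℝ] V)
    (hK : ∀ x y z : V,
      2 * g (nabla x y) z
        = g (mul z x - mul x z) y + g (mul z y - mul y z) x
          + g (mul x y - mul y x) z) :
    (∀ x y : V, P x = x → P y = y → nabla x y = mul x y) ∧
    (∀ ξ η : V, P ξ = -ξ → P η = -η → nabla ξ η = mul ξ η) := by
  have hPskew : ∀ x z : V, ω x (P z) = - ω (P x) z := by
    intro x z
    have h := hPω x (P z)
    rw [hP2] at h
    linarith
  have eq_of_pairing : ∀ a b : V, (∀ z : V, ω a z = ω b z) → a = b := by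
    intro a b h
    refine sub_eq_zero.mp (hnd _ fun z => ?_)
    rw [map_sub, LinearMap.sub_apply, h z, sub_self]
  have hbracket : ∀ x y z : V, ω (mul z x - mul x z) y = - ω (mul x y) z := by
    intro x y z
    have h := hinv x y z
    have h' := hωskew y (mul x z - mul z x)
    simp only [map_sub, LinearMap.sub_apply] at h h' ⊢
    linarith
  constructor
  · intro x y hx hy
    have hmul : ∀ a b : V, P a = a → P b = b → P (mul a b) = mul a b := by
      intro a b ha hb
      have h := hPint a b
      rw [ha, hb, eq_sub_iff_add_eq, ← two_smul ℝ, ← two_smul ℝ (mul a b)] at h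
      exact smul_right_injective V (two_ne_zero : (2 : ℝ) ≠ 0) h
    refine eq_of_pairing _ _ fun z => ?_
    have h := hK x y (P z)
    rw [hg, hg, hg, hg, hP2, hx, hy, hbracket, hbracket, hPskew, hPskew,
      hmul x y hx hy, hmul y x hy hx, map_sub, LinearMap.sub_apply] at h
    linarith
  · intro x y hx hy
    have hmul : ∀ a b : V, P a = -a → P b = -b → P (mul a b) = -mul a b := by
      intro a b ha hb
      have h := hPint a b
      simp only [ha, hb, map_neg, LinearMap.neg_apply, neg_neg] at h
      rw [eq_sub_iff_add_eq, ← two_smul ℝ, ← two_smul ℝ (-mul a b)] at h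
      exact smul_right_injective V (two_ne_zero : (2 : ℝ) ≠ 0) h
    refine eq_of_pairing _ _ fun z => ?_
    have h := hK x y (P z)
    rw [hg, hg, hg, hg, hP2, hx, hy, map_neg, map_neg, hbracket, hbracket, hPskew, hPskew,
      hmul x y hx hy, hmul y x hy hx] at h
    simp only [map_neg, map_sub, LinearMap.sub_apply, LinearMap.neg_apply] at h
    linarith
end
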